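/- arXiv:2110.10921 — 3 statements merged into one kernel-verified Lean document; each statement's English description precedes it below -/
import Mathlib

section
/- Let U be a finite set and f a real-valued function on finsets of U that is monotone (I ⊆ J implies f(I) ≤ f(J)) and submodular (for I ⊆ J and i ∉ J, f(I ∪ {i}) − f(I) ≥ f(J ∪ {i}) − f(J)). Let d ≥ 1, let S* ⊆ U with |S*| = d, let I ⊆ U be any finset, and let i* ∈ U \ I be an element maximizing the marginal gain f(I ∪ {i}) − f(I) over all i ∈ U \ I (assume U \ I is nonempty). Then f(S*) − f(I ∪ {i*}) ≤ (1 − 1/d) · (f(S*) − f(I)). -/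
/-- A monotone submodular function gains at most the sum of the marginal gains
when a finset is adjoined. -/
theorem apply_union_le_add_sum_marginal {U : Type*} [DecidableEq U] (f : Finset U → ℝ)
    (hmono : ∀ I J : Finset U, I ⊆ J → f I ≤ f J)
    (hsub : ∀ I J : Finset U, I ⊆ J → ∀ i ∉ J,
      f (insert i J) - f J ≤ f (insert i I) - f I)
    (I T : Finset U) :
    f (T ∪ I) ≤ f I + ∑ i ∈ T, (f (insert i I) - f I) := by
  induction T using Finset.induction_on with
  | empty => simp
  | insert a T ha ih =>
    rw [Finset.sum_insert ha, Finset.insert_union]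
    by_cases h : a ∈ T ∪ I
    · rw [Finset.insert_eq_of_mem h]
      linarith [hmono I (insert a I) (Finset.subset_insert a I)]
    · linarith [hsub I (T ∪ I) Finset.subset_union_right a h]

/-- Per-step greedy inequality (Nemhauser–Wolsey–Fisher, used in Theorem 1):
for a monotone submodular `f`, if `i*` maximizes the marginal gain over `U \ I`,
then `f(S*) − f(I ∪ {i*}) ≤ (1 − 1/d) (f(S*) − f(I))` for any `S*` with `|S*| = d`. -/
theorem greedy_step_bound {U : Type*} [Fintype U] [DecidableEq U]
    (f : Finset U → ℝ)
    (hmono : ∀ I J : Finset U, I ⊆ J → f I ≤ f J)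
    (hsub : ∀ I J : Finset U, I ⊆ J → ∀ i ∉ J,
      f (insert i J) - f J ≤ f (insert i I) - f I)
    (d : ℕ) (hd : 1 ≤ d)
    (Sstar : Finset U) (hS : Sstar.card = d)
    (I : Finset U) (istar : U) (histar : istar ∈ Finset.univ \ I)
    (hmax : ∀ i ∈ Finset.univ \ I,
      f (insert i I) - f I ≤ f (insert istar I) - f I) :
    f Sstar - f (insert istar I) ≤ (1 - 1 / (d : ℝ)) * (f Sstar - f I) := by
  have hgain : ∀ i ∈ Sstar, f (insert i I) - f I ≤ f (insert istar I) - f I := by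
    intro i _
    by_cases hi : i ∈ I
    · rw [Finset.insert_eq_of_mem hi, sub_self, sub_nonneg]
      exact hmono _ _ (Finset.subset_insert istar I)
    · exact hmax i (by simp [hi])
  have hsum := Finset.sum_le_card_nsmul Sstar _ _ hgain
  rw [hS, nsmul_eq_mul] at hsum
  have hd0 : (0 : ℝ) < d := by exact_mod_cast hd
  have hdiv : (f Sstar - f I) / d ≤ f (insert istar I) - f I := by
    rw [div_le_iff₀' hd0]
    linarith [hmono Sstar (Sstar ∪ I) Finset.subset_union_left,
      apply_union_le_add_sum_marginal f hmono hsub I Sstar]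
  calc f Sstar - f (insert istar I)
      ≤ (f Sstar - f I) - (f Sstar - f I) / d := by linarith
    _ = (1 - 1 / (d : ℝ)) * (f Sstar - f I) := by ring
end

section
/- Let U be a finite set, f a monotone submodular real-valued function on finsets of U with f(∅) = 0, and d an integer with 1 ≤ d ≤ |U|. Define the greedy sequence I^0 = ∅ and I^{t+1} = I^t ∪ {i_t}, where at each step i_t ∈ U \ I^t maximizes the marginal gain f(I^t ∪ {i}) − f(I^t) over i ∈ U \ I^t. Then for every S* ⊆ U with |S*| = d, the greedy set after d steps satisfies f(I^d) ≥ (1 − (1 − 1/d)^d) · f(S*). -/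
/-- For a monotone submodular function, the gain of adding a set `S` to `A` is at most the sum
of the marginal gains of its elements. -/
theorem union_sub_le_sum_marginal {U : Type*} [DecidableEq U] {f : Finset U → ℝ}
    (hmono : ∀ I J : Finset U, I ⊆ J → f I ≤ f J)
    (hsub : ∀ I J : Finset U, I ⊆ J → ∀ i ∉ J,
      f (insert i J) - f J ≤ f (insert i I) - f I) (A S : Finset U) :
    f (A ∪ S) - f A ≤ ∑ i ∈ S, (f (insert i A) - f A) := by
  induction S using Finset.induction_on with
  | empty => simp
  | insert i S hi ih =>
    rw [Finset.sum_insert hi, Finset.union_insert]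
    by_cases h : i ∈ A ∪ S
    · rw [Finset.insert_eq_of_mem h]
      linarith [hmono A (insert i A) (Finset.subset_insert i A)]
    · linarith [hsub A (A ∪ S) Finset.subset_union_left i h]

/-- If all marginal gains at `A` are at most that of `g`, then `f S` exceeds `f A` by at most
`S.card` times the marginal gain of `g`. -/
theorem sub_le_card_mul_max_marginal {U : Type*} [DecidableEq U] {f : Finset U → ℝ}
    (hmono : ∀ I J : Finset U, I ⊆ J → f I ≤ f J)
    (hsub : ∀ I J : Finset U, I ⊆ J → ∀ i ∉ J,
      f (insert i J) - f J ≤ f (insert i I) - f I) (A S : Finset U) (g : U)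
    (hg : ∀ i ∉ A, f (insert i A) - f A ≤ f (insert g A) - f A) :
    f S - f A ≤ S.card * (f (insert g A) - f A) := by
  have hle : ∀ i ∈ S, f (insert i A) - f A ≤ f (insert g A) - f A := by
    intro i _
    by_cases h : i ∈ A
    · rw [Finset.insert_eq_of_mem h]
      linarith [hmono A (insert g A) (Finset.subset_insert g A)]
    · exact hg i h
  have hsum := Finset.sum_le_card_nsmul S _ _ hle
  rw [nsmul_eq_mul] at hsum
  linarith [hmono S (A ∪ S) Finset.subset_union_right,
    union_sub_le_sum_marginal hmono hsub A S]


/-- Greedy approximation guarantee inside Theorem 1: for a normalized monotone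
submodular `f` and the greedy sequence `I⁰ = ∅`, `I^{t+1} = I^t ∪ {i_t}` with
`i_t` maximizing the marginal gain, `f(I^d) ≥ (1 − (1 − 1/d)^d) f(S*)`
for every `S*` with `|S*| = d`. -/
theorem greedy_approximation {U : Type*} [Fintype U] [DecidableEq U]
    (f : Finset U → ℝ)
    (hmono : ∀ I J : Finset U, I ⊆ J → f I ≤ f J)
    (hsub : ∀ I J : Finset U, I ⊆ J → ∀ i ∉ J,
      f (insert i J) - f J ≤ f (insert i I) - f I)
    (hzero : f ∅ = 0)
    (d : ℕ) (hd1 : 1 ≤ d) (hd2 : d ≤ Fintype.card U)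
    (I : ℕ → Finset U) (g : ℕ → U)
    (hI0 : I 0 = ∅)
    (hstep : ∀ t < d, g t ∉ I t ∧
      (∀ i ∉ I t, f (insert i (I t)) - f (I t) ≤ f (insert (g t) (I t)) - f (I t)) ∧
      I (t + 1) = insert (g t) (I t))
    (Sstar : Finset U) (hS : Sstar.card = d) :
    f (I d) ≥ (1 - (1 - 1 / (d : ℝ)) ^ d) * f Sstar := by
  have hd : (1 : ℝ) ≤ d := by exact_mod_cast hd1
  have hr : 0 ≤ 1 - 1 / (d : ℝ) := by
    rw [sub_nonneg, div_le_one (by linarith)]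
    exact hd
  have gap : ∀ t ≤ d, f Sstar - f (I t) ≤ (1 - 1 / (d : ℝ)) ^ t * f Sstar := by
    intro t
    induction t with
    | zero => simp [hI0, hzero]
    | succ t ih =>
      intro ht
      obtain ⟨-, hmax, hnext⟩ := hstep t ht
      have hgain := sub_le_card_mul_max_marginal hmono hsub (I t) Sstar (g t) hmax
      rw [hS, ← hnext, ← div_le_iff₀' (by linarith)] at hgain
      calc f Sstar - f (I (t + 1))
          ≤ (1 - 1 / (d : ℝ)) * (f Sstar - f (I t)) := by
            rw [sub_mul, one_div_mul_eq_div]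
            linarith
        _ ≤ (1 - 1 / (d : ℝ)) * ((1 - 1 / (d : ℝ)) ^ t * f Sstar) :=
            mul_le_mul_of_nonneg_left (ih (by omega)) hr
        _ = (1 - 1 / (d : ℝ)) ^ (t + 1) * f Sstar := by ring
  linarith [gap d le_rfl]
end

section
/- Let U be a finite set, f a monotone submodular real-valued function on finsets of U with f(∅) = 0, and d an integer with 1 ≤ d ≤ |U|. Define the greedy sequence I^0 = ∅ and I^{t+1} = I^t ∪ {i_t}, where at each step i_t ∈ U \ I^t maximizes the marginal gain f(I^t ∪ {i}) − f(I^t) over i ∈ U \ I^t. Then for every S* ⊆ U with |S*| = d, f(I^d) ≥ (1 − 1/e) · f(S*), where e = Real.exp 1. -/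
/-- If every marginal gain at `A` is at most `δ`, then a submodular function gains at most
`#S * δ` by adjoining `S` to `A`. -/
theorem submodular_union_sub_le {U : Type*} [DecidableEq U] {f : Finset U → ℝ}
    (hsub : ∀ I J : Finset U, I ⊆ J → ∀ i ∉ J,
      f (insert i J) - f J ≤ f (insert i I) - f I)
    {A : Finset U} {δ : ℝ} (hδ : 0 ≤ δ) (hA : ∀ i ∉ A, f (insert i A) - f A ≤ δ)
    (S : Finset U) : f (A ∪ S) - f A ≤ S.card * δ := by
  induction S using Finset.induction_on with
  | empty => simp
  | insert a S ha ih =>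
    rw [Finset.card_insert_of_notMem ha, Finset.union_insert]
    push_cast
    by_cases h : a ∈ A ∪ S
    · rw [Finset.insert_eq_of_mem h]
      linarith
    · have h₁ := hsub A (A ∪ S) Finset.subset_union_left a h
      have h₂ := hA a fun h' => h (Finset.mem_union_left S h')
      linarith

/-- Value guarantee underlying Theorem 1: for a normalized monotone submodular `f`
and the greedy sequence `I⁰ = ∅`, `I^{t+1} = I^t ∪ {i_t}` with `i_t` maximizing the
marginal gain, `f(I^d) ≥ (1 − 1/e) f(S*)` for every `S*` with `|S*| = d`. -/
theorem greedy_one_sub_inv_e {U : Type*} [Fintype U] [DecidableEq U]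
    (f : Finset U → ℝ)
    (hmono : ∀ I J : Finset U, I ⊆ J → f I ≤ f J)
    (hsub : ∀ I J : Finset U, I ⊆ J → ∀ i ∉ J,
      f (insert i J) - f J ≤ f (insert i I) - f I)
    (hzero : f ∅ = 0)
    (d : ℕ) (hd1 : 1 ≤ d) (hd2 : d ≤ Fintype.card U)
    (I : ℕ → Finset U) (g : ℕ → U)
    (hI0 : I 0 = ∅)
    (hstep : ∀ t < d, g t ∉ I t ∧
      (∀ i ∉ I t, f (insert i (I t)) - f (I t) ≤ f (insert (g t) (I t)) - f (I t)) ∧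
      I (t + 1) = insert (g t) (I t))
    (Sstar : Finset U) (hS : Sstar.card = d) :
    f (I d) ≥ (1 - 1 / Real.exp 1) * f Sstar := by
  have hd : (0 : ℝ) < d := by exact_mod_cast hd1
  have hd_one : (1 : ℝ) ≤ d := by exact_mod_cast hd1
  have contraction : ∀ t < d,
      f Sstar - f (I (t + 1)) ≤ (1 - 1 / d) * (f Sstar - f (I t)) := by
    intro t ht
    obtain ⟨-, hmax, hnext⟩ := hstep t ht
    have hgain := submodular_union_sub_le hsub
      (sub_nonneg.2 (hmono _ _ (Finset.subset_insert (g t) (I t)))) hmax Sstar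
    have hle := hmono Sstar (I t ∪ Sstar) Finset.subset_union_right
    rw [hS, ← hnext] at hgain
    have hdiv : (f Sstar - f (I t)) / d ≤ f (I (t + 1)) - f (I t) := by
      rw [div_le_iff₀ hd]
      linarith
    calc f Sstar - f (I (t + 1)) ≤ (f Sstar - f (I t)) - (f Sstar - f (I t)) / d := by linarith
      _ = (1 - 1 / d) * (f Sstar - f (I t)) := by ring
  have hfactor : (0 : ℝ) ≤ 1 - 1 / d := sub_nonneg.2 ((div_le_one hd).2 hd_one)
  have gap : ∀ t ≤ d, f Sstar - f (I t) ≤ (1 - 1 / d) ^ t * f Sstar := by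
    intro t
    induction t with
    | zero => simp [hI0, hzero]
    | succ t ih =>
      intro ht
      calc f Sstar - f (I (t + 1)) ≤ (1 - 1 / d) * (f Sstar - f (I t)) := contraction t ht
        _ ≤ (1 - 1 / d) * ((1 - 1 / d) ^ t * f Sstar) := by
          gcongr
          exact ih (by omega)
        _ = (1 - 1 / d) ^ (t + 1) * f Sstar := by ring
  have hexp : (1 - 1 / (d : ℝ)) ^ d ≤ 1 / Real.exp 1 := by
    simpa [Real.exp_neg] using Real.one_sub_div_pow_le_exp_neg hd_one
  have hnonneg : 0 ≤ f Sstar := hzero ▸ hmono ∅ Sstar (Finset.empty_subset _)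
  linarith [gap d le_rfl, mul_le_mul_of_nonneg_right hexp hnonneg]
end
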